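/- arXiv:2206.03908 — 4 statements merged into one kernel-verified Lean document; each statement's English description precedes it below -/
import Mathlib

section
/- The map sending a pair of positive integers (a,b) to its direction list d_{a,b} is injective: if a, a', b, b' are positive integers and the lists d_{a,b} and d_{a',b'} are equal, then a = a' and b = b'. -/
/-- The direction list of dimensions `(a, b)`: the list of length `a * b` whose
`i`-th entry is the bit `(i / a) % 2`. -/
def dirList (a b : ℕ) : List ℕ :=
  (List.range (a * b)).map fun i => (i / a) % 2

theorem length_dirList (a b : ℕ) : (dirList a b).length = a * b := by
  simp [dirList]

theorem getElem?_dirList {a b i : ℕ} (hi : i < a * b) :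
    (dirList a b)[i]? = some (i / a % 2) := by
  simp [dirList, hi]

/-- Equal direction lists cannot have row lengths `a < a'`: they differ at index `a`. -/
theorem le_of_dirList_eq {a b a' b' : ℕ} (ha : 1 ≤ a) (hb' : 1 ≤ b')
    (h : dirList a b = dirList a' b') : a' ≤ a := by
  by_contra! hlt
  have hlen : a * b = a' * b' := by
    simpa only [length_dirList] using congrArg List.length h
  have hi : a < a' * b' := hlt.trans_le (Nat.le_mul_of_pos_right a' hb')
  have hget := getElem?_dirList hi
  rw [← h, getElem?_dirList (hlen ▸ hi), Nat.div_self ha, Nat.div_eq_of_lt hlt] at hget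
  simp at hget

theorem stmt3 (a b a' b' : ℕ) (ha : 1 ≤ a) (hb : 1 ≤ b)
    (ha' : 1 ≤ a') (hb' : 1 ≤ b')
    (h : dirList a b = dirList a' b') : a = a' ∧ b = b' := by
  obtain rfl : a = a' :=
    le_antisymm (le_of_dirList_eq ha' hb h.symm) (le_of_dirList_eq ha hb' h)
  have hlen : a * b = a * b' := by
    simpa only [length_dirList] using congrArg List.length h
  exact ⟨rfl, Nat.eq_of_mul_eq_mul_left ha hlen⟩
end

section
/- Suppose S and S' are shapes whose minimum bounding boxes are {0,…,a−1}×{0,…,b−1}×{0,…,c−1} and {0,…,a'−1}×{0,…,b'−1}×{0,…,c'−1} respectively (a,b,c,a',b',c' ≥ 1). If the direction lists d_{a,b} and d_{a',b'} are equal, and the indicator lists of S and S' are equal (the indicator list of S has length abc with i-th entry recording whether e_{a,b,c}(i) ∈ S), then a = a', b = b', c = c' and S = S'. In other words, a shape normalized so that its minimum bounding box has its minimal corner at the origin is uniquely recoverable from its binary encoding consisting of the direction list followed by the indicator list. -/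
/-- Points of the cubic lattice `ℤ³`. -/
abbrev V4 := Fin 3 → ℤ

/-- Two points of `ℤ³` are grid-adjacent if they differ by exactly 1 in one
coordinate and agree in the other two. -/
def gridAdjacent (p q : V4) : Prop :=
  ∃ j, (p j - q j = 1 ∨ q j - p j = 1) ∧ ∀ k, k ≠ j → p k = q k

/-- One step of a grid path staying inside `A`. -/
def adjIn (A : Set V4) (p q : V4) : Prop :=
  p ∈ A ∧ q ∈ A ∧ gridAdjacent p q

/-- A set is grid-connected if any two of its points are joined by a path of
grid-adjacent points inside the set. -/
def gridConnected (A : Set V4) : Prop :=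
  ∀ p ∈ A, ∀ q ∈ A, Relation.ReflTransGen (adjIn A) p q

/-- A shape is a nonempty finite grid-connected subset of `ℤ³`. -/
def IsShape (S : Set V4) : Prop := S.Nonempty ∧ S.Finite ∧ gridConnected S

/-- The zig-zag (boustrophedon) enumeration of an `a × b` grid. -/
def zig (a i : ℕ) : ℕ × ℕ :=
  (if (i / a) % 2 = 0 then i % a else a - 1 - i % a, i / a)

/-- The slice-by-slice zig-zag enumeration of an `a × b × c` grid, viewed as a
point of `ℤ³`. -/
def e3 (a b : ℕ) (i : ℕ) : V4 :=
  ![((zig a (i % (a * b))).1 : ℤ), ((zig a (i % (a * b))).2 : ℤ),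
    ((i / (a * b) : ℕ) : ℤ)]

/-- The indicator list of a set `S` relative to dimensions `(a, b, c)`: the
list of length `a * b * c` whose `i`-th entry records whether the `i`-th point
of the slice-by-slice zig-zag enumeration belongs to `S`. -/
def indList (a b c : ℕ) (S : Set V4) : List Prop :=
  (List.range (a * b * c)).map fun i => e3 a b i ∈ S

/-- `S` has minimum bounding box `{0,…,a−1} × {0,…,b−1} × {0,…,c−1}`:
`S` lies inside that box and attains each of the six faces. -/
def MinBBoxIs (S : Set V4) (a b c : ℕ) : Prop :=
  (∀ p ∈ S, ∀ j : Fin 3, 0 ≤ p j ∧ p j ≤ ![(a : ℤ), (b : ℤ), (c : ℤ)] j - 1) ∧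
  (∀ j : Fin 3, ∃ p ∈ S, p j = 0) ∧
  (∀ j : Fin 3, ∃ p ∈ S, p j = ![(a : ℤ), (b : ℤ), (c : ℤ)] j - 1)

theorem dirList_getElem? {a b i : ℕ} (hi : i < a * b) :
    (dirList a b)[i]? = some ((i / a) % 2) := by
  simp [dirList, hi]

theorem length_indList (a b c : ℕ) (S : Set V4) : (indList a b c S).length = a * b * c := by
  simp [indList]

theorem zig_surjective {a x y : ℕ} (hx : x < a) :
    ∃ j < a, zig a (y * a + j) = (x, y) := by
  have ha : 0 < a := by omega
  have hdiv : ∀ j < a, (y * a + j) / a = y := fun j hj => by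
    rw [Nat.mul_comm, Nat.mul_add_div ha, Nat.div_eq_of_lt hj, Nat.add_zero]
  have hmod : ∀ j < a, (y * a + j) % a = j := fun j hj => by
    rw [Nat.mul_comm, Nat.mul_add_mod, Nat.mod_eq_of_lt hj]
  by_cases hy : y % 2 = 0
  · exact ⟨x, hx, by simp [zig, hdiv x hx, hmod x hx, hy]⟩
  · have hj : a - 1 - x < a := by omega
    refine ⟨a - 1 - x, hj, ?_⟩
    simp only [zig, hdiv _ hj, hmod _ hj, hy, if_false, Prod.mk.injEq, and_true]
    omega

theorem e3_surjective {a b c x y z : ℕ} (hx : x < a) (hy : y < b) (hz : z < c) :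
    ∃ i < a * b * c, e3 a b i = ![(x : ℤ), (y : ℤ), (z : ℤ)] := by
  obtain ⟨j, hj, hzig⟩ := zig_surjective (y := y) hx
  have hk : y * a + j < a * b := by nlinarith
  refine ⟨a * b * z + (y * a + j), by nlinarith [Nat.mul_le_mul_left (a * b) hz], ?_⟩
  have hdiv : (a * b * z + (y * a + j)) / (a * b) = z := by
    rw [Nat.mul_add_div (by omega), Nat.div_eq_of_lt hk, Nat.add_zero]
  have hmod : (a * b * z + (y * a + j)) % (a * b) = y * a + j := by
    rw [Nat.mul_add_mod, Nat.mod_eq_of_lt hk]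
  simp only [e3, hdiv, hmod, hzig]

theorem MinBBoxIs.exists_e3_eq {S : Set V4} {a b c : ℕ} (h : MinBBoxIs S a b c)
    {p : V4} (hp : p ∈ S) : ∃ i < a * b * c, e3 a b i = p := by
  have h0 := h.1 p hp 0
  have h1 := h.1 p hp 1
  have h2 := h.1 p hp 2
  simp at h0 h1 h2
  obtain ⟨i, hi, hip⟩ := e3_surjective (a := a) (b := b) (c := c)
    (x := (p 0).toNat) (y := (p 1).toNat) (z := (p 2).toNat)
    (by omega) (by omega) (by omega)
  refine ⟨i, hi, ?_⟩
  rw [hip]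
  ext k
  fin_cases k <;> simp <;> omega

theorem mem_iff_of_indList_eq {S S' : Set V4} {a b c i : ℕ}
    (h : indList a b c S = indList a b c S') (hi : i < a * b * c) :
    e3 a b i ∈ S ↔ e3 a b i ∈ S' :=
  iff_of_eq (List.map_inj_left.mp h i (List.mem_range.mpr hi))

theorem stmt4 (a b c a' b' c' : ℕ)
    (ha : 1 ≤ a) (hb : 1 ≤ b) (hc : 1 ≤ c)
    (ha' : 1 ≤ a') (hb' : 1 ≤ b') (hc' : 1 ≤ c')
    (S S' : Set V4) (hS : IsShape S) (hS' : IsShape S')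
    (hbox : MinBBoxIs S a b c) (hbox' : MinBBoxIs S' a' b' c')
    (hdir : dirList a b = dirList a' b')
    (hind : indList a b c S = indList a' b' c' S') :
    a = a' ∧ b = b' ∧ c = c' ∧ S = S' := by
  obtain rfl : a = a' :=
    le_antisymm (le_of_dirList_eq ha' hb hdir.symm) (le_of_dirList_eq ha hb' hdir)
  obtain rfl : b = b' := by
    have hlen := congrArg List.length hdir
    rw [length_dirList, length_dirList] at hlen
    exact Nat.eq_of_mul_eq_mul_left ha hlen
  obtain rfl : c = c' := by
    have hlen := congrArg List.length hind
    rw [length_indList, length_indList] at hlen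
    exact Nat.eq_of_mul_eq_mul_left (Nat.mul_pos ha hb) hlen
  refine ⟨rfl, rfl, rfl, Set.Subset.antisymm (fun p hp => ?_) (fun p hp => ?_)⟩
  · obtain ⟨i, hi, rfl⟩ := hbox.exists_e3_eq hp
    exact (mem_iff_of_indList_eq hind hi).mp hp
  · obtain ⟨i, hi, rfl⟩ := hbox'.exists_e3_eq hp
    exact (mem_iff_of_indList_eq hind hi).mpr hp
end

section
/- Let N = {e₁, −e₁, e₂, −e₂, e₃, −e₃} ⊆ ℤ³ be the set of six unit coordinate vectors and their negatives, and let the group G of 3×3 integer orthogonal matrices of determinant 1 act on subsets of N elementwise. Then the number of G-orbits of subsets of N of cardinality k is: 1 for k = 1, 2 for k = 2, 2 for k = 3, 2 for k = 4, 1 for k = 5, and 1 for k = 6. -/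
/-- `R` is a rotational symmetry of the cubic lattice: an integer matrix with
`Rᵀ * R = 1` and `det R = 1`. -/
def InG (R : Matrix (Fin 3) (Fin 3) ℤ) : Prop :=
  R.transpose * R = 1 ∧ R.det = 1

/-- The set `N = {e₁, −e₁, e₂, −e₂, e₃, −e₃}` of the six unit coordinate
vectors and their negatives. -/
def N3 : Set (Fin 3 → ℤ) :=
  {d | ∃ j, (d j = 1 ∨ d j = -1) ∧ ∀ k, k ≠ j → d k = 0}

/-- The orbit of a subset `A ⊆ ℤ³` under the elementwise action of the
rotation group. -/
def orbitOf (A : Set (Fin 3 → ℤ)) : Set (Set (Fin 3 → ℤ)) :=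
  {B | ∃ R, InG R ∧ B = (fun p => R.mulVec p) '' A}

/-- The number of orbits of subsets of `N3` of cardinality `k` under the
rotation group. -/
noncomputable def orbCount (k : ℕ) : ℕ :=
  {O : Set (Set (Fin 3 → ℤ)) |
    ∃ A, A ⊆ N3 ∧ A.ncard = k ∧ O = orbitOf A}.ncard

/-- The six unit directions, with `2 * j` and `2 * j + 1` indexing `e_j` and `-e_j`. -/
def latticeDir : Fin 6 → Fin 3 → ℤ :=
  ![![1, 0, 0], ![-1, 0, 0], ![0, 1, 0], ![0, -1, 0], ![0, 0, 1], ![0, 0, -1]]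

lemma latticeDir_injective : Function.Injective latticeDir := by
  unfold Function.Injective
  decide

lemma range_latticeDir : Set.range latticeDir = N3 := by
  ext d
  constructor
  · rintro ⟨i, rfl⟩
    revert i
    unfold N3
    simp only [Set.mem_ofPred_eq]
    decide
  · rintro ⟨j, hj, h0⟩
    fin_cases j <;> rcases hj with hj | hj
    · exact ⟨0, by ext k; fin_cases k <;> simp_all [latticeDir]⟩
    · exact ⟨1, by ext k; fin_cases k <;> simp_all [latticeDir]⟩
    · exact ⟨2, by ext k; fin_cases k <;> simp_all [latticeDir]⟩
    · exact ⟨3, by ext k; fin_cases k <;> simp_all [latticeDir]⟩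
    · exact ⟨4, by ext k; fin_cases k <;> simp_all [latticeDir]⟩
    · exact ⟨5, by ext k; fin_cases k <;> simp_all [latticeDir]⟩

lemma InG.one : InG 1 := by simp [InG]

lemma InG.mul {R S : Matrix (Fin 3) (Fin 3) ℤ} (hR : InG R) (hS : InG S) : InG (R * S) := by
  refine ⟨?_, by rw [Matrix.det_mul, hR.2, hS.2, one_mul]⟩
  rw [Matrix.transpose_mul, Matrix.mul_assoc, ← Matrix.mul_assoc _ R, hR.1, Matrix.one_mul, hS.1]

lemma InG.transpose {R : Matrix (Fin 3) (Fin 3) ℤ} (hR : InG R) : InG R.transpose :=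
  ⟨by rw [Matrix.transpose_transpose]; exact mul_eq_one_comm.mp hR.1,
    by rw [Matrix.det_transpose, hR.2]⟩

lemma InG.mulVec_injective {R : Matrix (Fin 3) (Fin 3) ℤ} (hR : InG R) :
    Function.Injective (fun p => R.mulVec p) := fun p q h => by
  simpa [Matrix.mulVec_mulVec, hR.1] using congrArg (fun v => R.transpose.mulVec v) h

lemma mem_orbitOf_self (A : Set (Fin 3 → ℤ)) : A ∈ orbitOf A :=
  ⟨1, InG.one, by simp⟩

lemma orbitOf_image_subset {R : Matrix (Fin 3) (Fin 3) ℤ} (hR : InG R) (A : Set (Fin 3 → ℤ)) :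
    orbitOf ((fun p => R.mulVec p) '' A) ⊆ orbitOf A := by
  rintro _ ⟨S, hS, rfl⟩
  exact ⟨S * R, hS.mul hR, by simp [Set.image_image, Matrix.mulVec_mulVec]⟩

lemma orbitOf_image {R : Matrix (Fin 3) (Fin 3) ℤ} (hR : InG R) (A : Set (Fin 3 → ℤ)) :
    orbitOf ((fun p => R.mulVec p) '' A) = orbitOf A := by
  refine (orbitOf_image_subset hR A).antisymm ?_
  have h := orbitOf_image_subset hR.transpose ((fun p => R.mulVec p) '' A)
  simpa [Set.image_image, Matrix.mulVec_mulVec, hR.1] using h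

/-- The orbit of the set of directions with indices in `s`. -/
def dirOrbit (s : Finset (Fin 6)) : Set (Set (Fin 3 → ℤ)) :=
  orbitOf (latticeDir '' s)

lemma dirOrbit_image {R : Matrix (Fin 3) (Fin 3) ℤ} (hR : InG R) {f : Fin 6 → Fin 6}
    (hf : ∀ i, latticeDir (f i) = R.mulVec (latticeDir i)) (s : Finset (Fin 6)) :
    dirOrbit (s.image f) = dirOrbit s := by
  rw [dirOrbit, dirOrbit, ← orbitOf_image hR (latticeDir '' s), Finset.coe_image, Set.image_image, Set.image_image]
  simp only [hf]

/-- The action on direction indices of the quarter turn about the first axis. -/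
def turnX : Fin 6 → Fin 6 := ![0, 1, 4, 5, 3, 2]

/-- The action on direction indices of the quarter turn about the third axis. -/
def turnZ : Fin 6 → Fin 6 := ![2, 3, 1, 0, 4, 5]

lemma dirOrbit_image_turnX (s : Finset (Fin 6)) : dirOrbit (s.image turnX) = dirOrbit s :=
  dirOrbit_image (R := !![1, 0, 0; 0, 0, -1; 0, 1, 0])
    ⟨by decide, by simp [Matrix.det_fin_three]⟩ (by decide) s

lemma dirOrbit_image_turnZ (s : Finset (Fin 6)) : dirOrbit (s.image turnZ) = dirOrbit s :=
  dirOrbit_image (R := !![0, -1, 0; 1, 0, 0; 0, 0, 1])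
    ⟨by decide, by simp [Matrix.det_fin_three]⟩ (by decide) s

/-- The image of a set of direction indices under a rotation given by Euler angles. -/
def eulerTurn (a b c : ℕ) (s : Finset (Fin 6)) : Finset (Fin 6) :=
  (Finset.image turnX)^[a] ((Finset.image turnZ)^[b] ((Finset.image turnX)^[c] s))

lemma dirOrbit_eulerTurn (a b c : ℕ) (s : Finset (Fin 6)) :
    dirOrbit (eulerTurn a b c s) = dirOrbit s := by
  have iter {f : Finset (Fin 6) → Finset (Fin 6)} (hf : ∀ s, dirOrbit (f s) = dirOrbit s)
      (n : ℕ) (s : Finset (Fin 6)) : dirOrbit (f^[n] s) = dirOrbit s := by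
    induction n generalizing s with
    | zero => rfl
    | succ n ih => rw [Function.iterate_succ_apply, ih, hf]
  rw [eulerTurn, iter dirOrbit_image_turnX, iter dirOrbit_image_turnZ, iter dirOrbit_image_turnX]

lemma orbCount_eq (k : ℕ) : orbCount k = (dirOrbit '' {s | s.card = k}).ncard := by
  unfold orbCount
  congr 1
  ext O
  constructor
  · rintro ⟨A, hA, hk, rfl⟩
    rw [← range_latticeDir, Set.subset_range_iff_exists_image_eq] at hA
    obtain ⟨t, rfl⟩ := hA
    lift t to Finset (Fin 6) using t.toFinite
    rw [Set.ncard_image_of_injective _ latticeDir_injective, Set.ncard_coe_finset] at hk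
    exact ⟨t, hk, rfl⟩
  · rintro ⟨s, hs, rfl⟩
    refine ⟨latticeDir '' s, ?_, ?_, rfl⟩
    · rw [← range_latticeDir]
      exact Set.image_subset_range _ _
    · rw [Set.ncard_image_of_injective _ latticeDir_injective, Set.ncard_coe_finset, hs]

/-- The number of points of `A` whose antipode also lies in `A`. -/
noncomputable def antipodalCount (A : Set (Fin 3 → ℤ)) : ℕ := {p ∈ A | -p ∈ A}.ncard

lemma antipodalCount_image {R : Matrix (Fin 3) (Fin 3) ℤ} (hR : InG R) (A : Set (Fin 3 → ℤ)) :
    antipodalCount ((fun p => R.mulVec p) '' A) = antipodalCount A := by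
  rw [antipodalCount, antipodalCount,
    ← Set.ncard_image_of_injective {p ∈ A | -p ∈ A} hR.mulVec_injective]
  congr 1
  have key (p : Fin 3 → ℤ) : -R.mulVec p ∈ (fun p => R.mulVec p) '' A ↔ -p ∈ A := by
    rw [← Matrix.mulVec_neg]
    exact hR.mulVec_injective.mem_set_image
  ext q
  constructor
  · rintro ⟨⟨p, hp, rfl⟩, hq⟩
    exact ⟨p, ⟨hp, (key p).1 hq⟩, rfl⟩
  · rintro ⟨p, ⟨hp, hn⟩, rfl⟩
    exact ⟨⟨p, hp, rfl⟩, (key p).2 hn⟩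

/-- The action on direction indices of negation. -/
def negDir : Fin 6 → Fin 6 := ![1, 0, 3, 2, 5, 4]

lemma antipodalCount_latticeDir (s : Finset (Fin 6)) :
    antipodalCount (latticeDir '' s) = (s.filter (negDir · ∈ s)).card := by
  have hneg : ∀ i, -latticeDir i = latticeDir (negDir i) := by decide
  rw [antipodalCount, ← Set.ncard_coe_finset, ← Set.ncard_image_of_injective _ latticeDir_injective]
  congr 1
  ext q
  constructor
  · rintro ⟨⟨i, hi, rfl⟩, hq⟩
    rw [hneg, latticeDir_injective.mem_set_image] at hq
    exact ⟨i, by simpa using ⟨hi, hq⟩, rfl⟩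
  · rintro ⟨i, hi, rfl⟩
    obtain ⟨hi, hn⟩ := Finset.mem_filter.1 hi
    exact ⟨⟨i, hi, rfl⟩, by rw [hneg, latticeDir_injective.mem_set_image]; exact hn⟩

lemma card_filter_negDir_of_dirOrbit_eq {s t : Finset (Fin 6)} (h : dirOrbit s = dirOrbit t) :
    (s.filter (negDir · ∈ s)).card = (t.filter (negDir · ∈ t)).card := by
  have hs : latticeDir '' s ∈ dirOrbit t := h ▸ mem_orbitOf_self _
  obtain ⟨R, hR, hst⟩ := hs
  rw [← antipodalCount_latticeDir, ← antipodalCount_latticeDir, hst, antipodalCount_image hR]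

lemma orbCount_eq_one {k : ℕ} (r : Finset (Fin 6)) (hr : r.card = k)
    (h : ∀ s : Finset (Fin 6), s.card = k → ∃ a b c : Fin 4, eulerTurn a b c s = r) :
    orbCount k = 1 := by
  rw [orbCount_eq, Set.ncard_eq_one]
  refine ⟨dirOrbit r, Set.Subset.antisymm ?_ ?_⟩
  · rintro _ ⟨s, hs, rfl⟩
    obtain ⟨a, b, c, rfl⟩ := h s hs
    exact (dirOrbit_eulerTurn a b c s).symm
  · rintro _ rfl
    exact ⟨r, hr, rfl⟩

lemma orbCount_eq_two {k : ℕ} (r t : Finset (Fin 6)) (hr : r.card = k) (ht : t.card = k)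
    (hne : (r.filter (negDir · ∈ r)).card ≠ (t.filter (negDir · ∈ t)).card)
    (h : ∀ s : Finset (Fin 6), s.card = k →
      ∃ a b c : Fin 4, eulerTurn a b c s = r ∨ eulerTurn a b c s = t) :
    orbCount k = 2 := by
  rw [orbCount_eq, Set.ncard_eq_two]
  refine ⟨dirOrbit r, dirOrbit t, mt card_filter_negDir_of_dirOrbit_eq hne,
    Set.Subset.antisymm ?_ ?_⟩
  · rintro _ ⟨s, hs, rfl⟩
    obtain ⟨a, b, c, rfl | rfl⟩ := h s hs
    · exact Or.inl (dirOrbit_eulerTurn a b c s).symm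
    · exact Or.inr (dirOrbit_eulerTurn a b c s).symm
  · rintro _ (rfl | rfl)
    · exact ⟨r, hr, rfl⟩
    · exact ⟨t, ht, rfl⟩

theorem stmt7 :
    orbCount 1 = 1 ∧ orbCount 2 = 2 ∧ orbCount 3 = 2 ∧
    orbCount 4 = 2 ∧ orbCount 5 = 1 ∧ orbCount 6 = 1 :=
  ⟨orbCount_eq_one {0} rfl (by decide +kernel),
    orbCount_eq_two {0, 1} {0, 2} rfl rfl (by decide) (by decide +kernel),
    orbCount_eq_two {0, 1, 2} {0, 2, 4} rfl rfl (by decide) (by decide +kernel),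
    orbCount_eq_two {0, 1, 2, 3} {0, 1, 2, 4} rfl rfl (by decide) (by decide +kernel),
    orbCount_eq_one {0, 1, 2, 3, 4} rfl (by decide +kernel),
    orbCount_eq_one Finset.univ rfl (by decide +kernel)⟩
end

section
/- Let B = {0,…,4}×{0,…,4}×{0,…,3} ⊆ ℤ³, let C₁ = {(1,4,1),(1,3,1),(1,2,1),(2,2,1)} and C₂ = {(1,4,1),(1,3,1),(1,2,1),(0,2,1)}, and define the shapes s₁ = B \ C₁ and s₂ = B \ C₂. Then there do not exist a matrix R in the group G of 3×3 integer orthogonal matrices of determinant 1 and a vector t ∈ ℤ³ such that {R·p + t : p ∈ s₁} = s₂; that is, s₁ and s₂ are not equivalent up to rotation and translation of ℤ³. -/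
/-- The box `{0,…,4} × {0,…,4} × {0,…,3} ⊆ ℤ³`. -/
def B554 : Set (Fin 3 → ℤ) :=
  {p | (0 ≤ p 0 ∧ p 0 ≤ 4) ∧ (0 ≤ p 1 ∧ p 1 ≤ 4) ∧ (0 ≤ p 2 ∧ p 2 ≤ 3)}

/-- The bent cavity turning in the `+x` direction. -/
def C1 : Set (Fin 3 → ℤ) :=
  {![1, 4, 1], ![1, 3, 1], ![1, 2, 1], ![2, 2, 1]}

/-- The bent cavity turning in the `−x` direction. -/
def C2 : Set (Fin 3 → ℤ) :=
  {![1, 4, 1], ![1, 3, 1], ![1, 2, 1], ![0, 2, 1]}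

theorem mem_B554_diff_C1_iff (a b c : ℤ) :
    ![a, b, c] ∈ B554 \ C1 ↔
      ((0 ≤ a ∧ a ≤ 4) ∧ (0 ≤ b ∧ b ≤ 4) ∧ (0 ≤ c ∧ c ≤ 3)) ∧
        ¬ (c = 1 ∧ (a = 1 ∧ (b = 4 ∨ b = 3 ∨ b = 2) ∨ a = 2 ∧ b = 2)) := by
  simp [B554, C1]
  omega

theorem mem_B554_diff_C2_iff (a b c : ℤ) :
    ![a, b, c] ∈ B554 \ C2 ↔
      ((0 ≤ a ∧ a ≤ 4) ∧ (0 ≤ b ∧ b ≤ 4) ∧ (0 ≤ c ∧ c ≤ 3)) ∧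
        ¬ (c = 1 ∧ (a = 1 ∧ (b = 4 ∨ b = 3 ∨ b = 2) ∨ a = 0 ∧ b = 2)) := by
  simp [B554, C2]
  omega

theorem mulVec_add_eq_vecCons (R : Matrix (Fin 3) (Fin 3) ℤ) (t : Fin 3 → ℤ) (a b c : ℤ) :
    R.mulVec ![a, b, c] + t =
      ![R 0 0 * a + R 0 1 * b + R 0 2 * c + t 0,
        R 1 0 * a + R 1 1 * b + R 1 2 * c + t 1,
        R 2 0 * a + R 2 1 * b + R 2 2 * c + t 2] := by
  ext i
  fin_cases i <;> simp [Matrix.mulVec, dotProduct, Fin.sum_univ_three]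

theorem planar_orthogonal_cases (a b d e : ℤ) (had : a * a + d * d = 1)
    (hbe : b * b + e * e = 1) (hab : a * b + d * e = 0) :
    (b = 0 ∧ d = 0 ∧ (a = 1 ∨ a = -1) ∧ (e = 1 ∨ e = -1)) ∨
      (a = 0 ∧ e = 0 ∧ (b = 1 ∨ b = -1) ∧ (d = 1 ∨ d = -1)) := by
  have ha₁ : -1 ≤ a := by nlinarith
  have ha₂ : a ≤ 1 := by nlinarith
  have hb₁ : -1 ≤ b := by nlinarith
  have hb₂ : b ≤ 1 := by nlinarith
  have hd₁ : -1 ≤ d := by nlinarith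
  have hd₂ : d ≤ 1 := by nlinarith
  have he₁ : -1 ≤ e := by nlinarith
  have he₂ : e ≤ 1 := by nlinarith
  interval_cases a <;> interval_cases d <;> interval_cases b <;> interval_cases e <;> omega

theorem stmt9 :
    ¬ ∃ (R : Matrix (Fin 3) (Fin 3) ℤ) (t : Fin 3 → ℤ),
      InG R ∧ (fun p => R.mulVec p + t) '' (B554 \ C1) = B554 \ C2 := by
  rintro ⟨R, t, ⟨hR, hdet⟩, himage⟩
  have hmap : ∀ a b c : ℤ, ![a, b, c] ∈ B554 \ C1 → R.mulVec ![a, b, c] + t ∈ B554 \ C2 :=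
    fun a b c h => himage ▸ Set.mem_image_of_mem _ h
  simp only [mulVec_add_eq_vecCons, mem_B554_diff_C1_iff, mem_B554_diff_C2_iff] at hmap
  have hcol : ∀ i j, R 0 i * R 0 j + R 1 i * R 1 j + R 2 i * R 2 j =
      (1 : Matrix (Fin 3) (Fin 3) ℤ) i j := by
    intro i j
    rw [← hR]
    simp [Matrix.mul_apply, Fin.sum_univ_three]
  have h00 : R 0 0 * R 0 0 + R 1 0 * R 1 0 + R 2 0 * R 2 0 = 1 := by simpa using hcol 0 0
  have h11 : R 0 1 * R 0 1 + R 1 1 * R 1 1 + R 2 1 * R 2 1 = 1 := by simpa using hcol 1 1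
  have h22 : R 0 2 * R 0 2 + R 1 2 * R 1 2 + R 2 2 * R 2 2 = 1 := by simpa using hcol 2 2
  have h01 : R 0 0 * R 0 1 + R 1 0 * R 1 1 + R 2 0 * R 2 1 = 0 := by simpa using hcol 0 1
  rw [Matrix.det_fin_three] at hdet
  generalize R 0 0 = a at *
  generalize R 0 1 = b at *
  generalize R 0 2 = c at *
  generalize R 1 0 = d at *
  generalize R 1 1 = e at *
  generalize R 1 2 = f at *
  generalize R 2 0 = g at *
  generalize R 2 1 = h at *
  generalize R 2 2 = k at *
  generalize t 0 = u at *
  generalize t 1 = v at *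
  generalize t 2 = w at *
  -- The corners of the box constrain the motion to be a symmetry of the box.
  have corner₀ := (hmap 0 0 0 (by simp)).1
  have corner₁ := (hmap 4 0 0 (by simp)).1
  have corner₂ := (hmap 0 4 0 (by simp)).1
  have corner₃ := (hmap 0 0 3 (by simp)).1
  have corner₄ := (hmap 4 4 0 (by simp)).1
  obtain rfl : g = 0 := by omega
  obtain rfl : h = 0 := by omega
  have hk : k ≠ 0 := by
    rintro rfl
    simp at hdet
  have hk2 : 1 ≤ k * k := by
    have := mul_self_pos.2 hk
    omega
  obtain rfl : c = 0 := mul_self_eq_zero.1 (by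
    linarith [mul_self_nonneg c, mul_self_nonneg f])
  obtain rfl : f = 0 := mul_self_eq_zero.1 (by linarith [mul_self_nonneg f])
  simp only [zero_mul, mul_zero, add_zero, zero_add] at h00 h11 h01 h22 corner₀ corner₃ corner₄
  obtain ⟨⟨hu₀, hu₄⟩, ⟨hv₀, hv₄⟩, hw₀, hw₃⟩ := corner₀
  obtain ⟨-, -, hkw₀, hkw₃⟩ := corner₃
  obtain ⟨⟨hau₀, hau₄⟩, ⟨hdv₀, hdv₄⟩, -⟩ := corner₄
  have hplane := planar_orthogonal_cases a b d e h00 h11 h01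
  clear corner₁ corner₂ hcol hR himage h00 h11 h01 hk2
  have hk_cases : k = 1 ∧ w = 0 ∨ k = -1 ∧ w = 3 := by
    clear hplane hmap hdet
    rcases mul_self_eq_one_iff.1 h22 with rfl | rfl <;> omega
  clear h22
  have hu : u = 2 - 2 * a - 2 * b := by
    clear hk_cases hmap hdet
    omega
  have hv : v = 2 - 2 * d - 2 * e := by
    clear hk_cases hmap hdet
    omega
  subst hu hv
  -- The preimages of `(1, 4, 1)` and `(0, 2, 1)` cannot both lie in the first cavity.
  have cell₁ := hmap (a * (2 * a + 2 * b - 1) + d * (2 * d + 2 * e + 2))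
    (b * (2 * a + 2 * b - 1) + e * (2 * d + 2 * e + 2)) (k * (1 - w))
  have cell₂ := hmap (a * (2 * a + 2 * b - 2) + d * (2 * d + 2 * e))
    (b * (2 * a + 2 * b - 2) + e * (2 * d + 2 * e)) (k * (1 - w))
  clear hmap
  rcases hk_cases with ⟨rfl, rfl⟩ | ⟨rfl, rfl⟩ <;>
    rcases hplane with ⟨rfl, rfl, rfl | rfl, rfl | rfl⟩ | ⟨rfl, rfl, rfl | rfl, rfl | rfl⟩ <;>
    first | (norm_num at hdet; done) | (norm_num at cell₁; done) | norm_num at cell₂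
end
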